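/- There do not exist integers n₁ < n₂ < n₃ < n₄ such that |nᵢ − nⱼ| ∈ {3, 4, 5, 7, 8, 9} for all i ≠ j. -/

import Mathlib

theorem no_four_pairwise_harmonic :
    ¬ ∃ n₁ n₂ n₃ n₄ : ℤ, n₁ < n₂ ∧ n₂ < n₃ ∧ n₃ < n₄ ∧
      (∀ a ∈ ({n₁, n₂, n₃, n₄} : Finset ℤ), ∀ b ∈ ({n₁, n₂, n₃, n₄} : Finset ℤ),
        a ≠ b → |a - b| ∈ ({3, 4, 5, 7, 8, 9} : Finset ℤ)) := by
  rintro ⟨a, b, c, d, hab, hbc, hcd, h⟩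
  have h1 := h b (by simp) a (by simp) (by omega)
  have h2 := h c (by simp) b (by simp) (by omega)
  have h3 := h d (by simp) c (by simp) (by omega)
  have h4 := h c (by simp) a (by simp) (by omega)
  have h5 := h d (by simp) a (by simp) (by omega)
  rw [abs_of_pos (by omega)] at h1 h2 h3 h4 h5
  simp only [Finset.mem_insert, Finset.mem_singleton] at h1 h2 h3 h4 h5
  have g1 : 3 ≤ b - a := by omega
  have g2 : 3 ≤ c - b := by omega
  have g3 : 3 ≤ d - c := by omega
  have g5 : d - a ≤ 9 := by omega
  have g4 : c - a = 6 := by omega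
  omega
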